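/- arXiv:2410.15441 — 3 statements merged into one kernel-verified Lean document; each statement's English description precedes it below -/
import Mathlib

section
/- Let n be a natural number, A : ℝ → (n × n real matrices) a continuous map, and let g, R : ℝ → (n × n real matrices) be differentiable with g'(t) = g(t)·A(t) and R'(t) = R(t)·A(t) for all t, and g(0) = 1 (identity matrix). Then R(t) = R(0)·g(t) for all t ∈ ℝ. -/
open Matrix

attribute [local instance] Matrix.normedAddCommGroup Matrix.normedSpace

/-- Two solutions of a linear ODE with continuous coefficients that agree at time `0` agree at
all times. -/
theorem linear_ODE_solution_unique {E : Type*} [NormedAddCommGroup E] [NormedSpace ℝ E]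
    {L : ℝ → E →L[ℝ] E} (hL : Continuous L) {x y : ℝ → E}
    (hx : ∀ t, HasDerivAt x (L t (x t)) t) (hy : ∀ t, HasDerivAt y (L t (y t)) t)
    (h0 : x 0 = y 0) : x = y := by
  funext t
  set T : ℝ := |t| + 1
  have hT : 0 < T := by positivity
  obtain ⟨K, hK⟩ := isCompact_Icc.exists_bound_of_continuousOn
    (hL.continuousOn (s := Set.Icc (-T) T))
  have hlip : ∀ s ∈ Set.Ioo (-T) T, LipschitzOnWith K.toNNReal (fun v => L s v) Set.univ := by
    intro s hs
    refine ((L s).lipschitz.weaken ?_).lipschitzOnWith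
    rw [← NNReal.coe_le_coe, coe_nnnorm]
    exact (hK s (Set.Ioo_subset_Icc_self hs)).trans (Real.le_coe_toNNReal K)
  refine ODE_solution_unique_of_mem_Ioo (v := fun s v => L s v) hlip
    (t₀ := 0) ⟨by linarith, hT⟩ (fun s _ => ⟨hx s, Set.mem_univ _⟩)
    (fun s _ => ⟨hy s, Set.mem_univ _⟩) h0 (abs_lt.mp ?_)
  exact lt_add_one |t|

/-- Right multiplication by a square real matrix, as a continuous linear map, depending linearly
on the matrix. -/
noncomputable def matrixMulRightCLM (n : ℕ) :
    Matrix (Fin n) (Fin n) ℝ →ₗ[ℝ] Matrix (Fin n) (Fin n) ℝ →L[ℝ] Matrix (Fin n) (Fin n) ℝ :=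
  LinearMap.toContinuousLinearMap.toLinearMap ∘ₗ (LinearMap.mul ℝ (Matrix (Fin n) (Fin n) ℝ)).flip

/-- All solutions of the matrix ODE `Ṙ = R·A(t)` are obtained by
left-translating the base solution `g` with `g(0) = 1`: `R(t) = R(0)·g(t)`. -/
theorem solutions_are_left_translates (n : ℕ)
    (A g R : ℝ → Matrix (Fin n) (Fin n) ℝ)
    (hA : Continuous A)
    (hg : ∀ t : ℝ, HasDerivAt g (g t * A t) t)
    (hR : ∀ t : ℝ, HasDerivAt R (R t * A t) t)
    (hg0 : g 0 = 1) :
    ∀ t : ℝ, R t = R 0 * g t := by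
  have hL : Continuous fun t => matrixMulRightCLM n (A t) :=
    (LinearMap.continuous_of_finiteDimensional (matrixMulRightCLM n)).comp hA
  have hRg : ∀ t, HasDerivAt (fun t => R 0 * g t) (R 0 * g t * A t) t := by
    intro t
    rw [mul_assoc]
    exact (LinearMap.toContinuousLinearMap
      (LinearMap.mulLeft ℝ (R 0))).hasFDerivAt.comp_hasDerivAt t (hg t)
  exact congrFun (linear_ODE_solution_unique hL hR hRg (by simp [hg0]))
end

section
/- Let n be a natural number and A : ℝ → (n × n real matrices) a continuous map with A(t)ᵀ = −A(t) for all t (skew-symmetric values). Let g : ℝ → (n × n real matrices) be differentiable with g'(t) = g(t)·A(t) for all t and g(0)·g(0)ᵀ = 1. Then g(t)·g(t)ᵀ = 1 for all t ∈ ℝ; i.e., the solution remains in the orthogonal group. -/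
open Matrix

attribute [local instance] Matrix.normedAddCommGroup Matrix.normedSpace

/-- The product rule for `g * gᵀ`, where `g` is a differentiable curve of matrices. -/
theorem Matrix.hasDerivAt_mul_transpose_self {m n : Type*} [Fintype m] [Fintype n]
    {g : ℝ → Matrix m n ℝ} {g' : Matrix m n ℝ} {t : ℝ} (hg : HasDerivAt g g' t) :
    HasDerivAt (fun s => g s * (g s)ᵀ) (g' * (g t)ᵀ + g t * g'ᵀ) t := by
  have entry (i : m) (k : n) : HasDerivAt (fun s => g s i k) (g' i k) t :=
    hasDerivAt_pi.1 (hasDerivAt_pi.1 hg i) k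
  refine hasDerivAt_pi.2 fun i => hasDerivAt_pi.2 fun j => ?_
  simpa only [Matrix.mul_apply, Matrix.add_apply, Matrix.transpose_apply,
    Finset.sum_add_distrib] using
    HasDerivAt.fun_sum (u := Finset.univ) fun k _ => (entry i k).fun_mul (entry j k)

/-- Solutions of `ġ = g·A(t)` with `A(t)` skew-symmetric that start in the
orthogonal group remain in the orthogonal group: `g(t)·g(t)ᵀ = 1` for all `t`. -/
theorem solution_stays_orthogonal (n : ℕ)
    (A g : ℝ → Matrix (Fin n) (Fin n) ℝ)
    (hA : Continuous A)
    (hskew : ∀ t : ℝ, (A t)ᵀ = -A t)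
    (hg : ∀ t : ℝ, HasDerivAt g (g t * A t) t)
    (hg0 : g 0 * (g 0)ᵀ = 1) :
    ∀ t : ℝ, g t * (g t)ᵀ = 1 := by
  have hderiv (s : ℝ) : HasDerivAt (fun s => g s * (g s)ᵀ) 0 s := by
    convert Matrix.hasDerivAt_mul_transpose_self (hg s) using 1
    rw [transpose_mul, hskew, neg_mul, mul_neg, Matrix.mul_assoc, add_neg_cancel]
  intro t
  rw [← hg0]
  exact is_const_of_deriv_eq_zero (fun s => (hderiv s).differentiableAt)
    (fun s => (hderiv s).deriv) t 0
end

section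
/- Let n be a natural number and A : ℝ → (n × n real matrices) a continuous map with A(t)ᵀ = −A(t) for all t. Let R, R' : ℝ → (n × n real matrices) be differentiable with R'(t) = R(t)·A(t) and (R')'(t) = R'(t)·A(t) for all t. Then trace((R(t) − R'(t))ᵀ (R(t) − R'(t))) = trace((R(0) − R'(0))ᵀ (R(0) − R'(0))) for all t ∈ ℝ; i.e., the Frobenius distance between any two trajectories is constant in time. -/
open Matrix

attribute [local instance] Matrix.normedAddCommGroup Matrix.normedSpace

theorem HasDerivAt.trace_transpose_mul_self {m n : Type*} [Fintype m] [Fintype n]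
    {D : ℝ → Matrix m n ℝ} {D' : Matrix m n ℝ} {t : ℝ} (hD : HasDerivAt D D' t) :
    HasDerivAt (fun s => ((D s)ᵀ * D s).trace) (D'ᵀ * D t + (D t)ᵀ * D').trace t := by
  have entry (i : m) (j : n) : HasDerivAt (fun s => D s i j) (D' i j) t :=
    hasDerivAt_pi.1 (hasDerivAt_pi.1 hD i) j
  simp only [Matrix.trace, Matrix.diag_apply, Matrix.add_apply, Matrix.mul_apply,
    Matrix.transpose_apply, ← Finset.sum_add_distrib]
  exact HasDerivAt.fun_sum fun j _ => HasDerivAt.fun_sum fun i _ => (entry i j).mul (entry i j)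

theorem Matrix.trace_transpose_mul_add_of_transpose_eq_neg {m n R : Type*} [Fintype m] [Fintype n]
    [CommRing R] (D : Matrix m n R) {A : Matrix n n R} (hA : Aᵀ = -A) :
    ((D * A)ᵀ * D + Dᵀ * (D * A)).trace = 0 := by
  rw [Matrix.transpose_mul, hA, Matrix.trace_add, Matrix.mul_assoc, ← Matrix.mul_assoc Dᵀ D A,
    Matrix.trace_mul_comm (Dᵀ * D) A, Matrix.neg_mul, Matrix.trace_neg, neg_add_cancel]

/-- For the matrix ODE `Ṙ = R·A(t)` with `A(t)` skew-symmetric, the Frobenius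
distance between any two trajectories is constant in time. -/
theorem frobenius_distance_constant (n : ℕ)
    (A R R' : ℝ → Matrix (Fin n) (Fin n) ℝ)
    (hA : Continuous A)
    (hskew : ∀ t : ℝ, (A t)ᵀ = -A t)
    (hR : ∀ t : ℝ, HasDerivAt R (R t * A t) t)
    (hR' : ∀ t : ℝ, HasDerivAt R' (R' t * A t) t) :
    ∀ t : ℝ, ((R t - R' t)ᵀ * (R t - R' t)).trace
      = ((R 0 - R' 0)ᵀ * (R 0 - R' 0)).trace := by
  intro t
  have hderiv (s : ℝ) :
      HasDerivAt (fun s => ((R s - R' s)ᵀ * (R s - R' s)).trace) 0 s := by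
    have hD : HasDerivAt (fun s => R s - R' s) ((R s - R' s) * A s) s := by
      rw [Matrix.sub_mul]
      exact (hR s).sub (hR' s)
    rw [← Matrix.trace_transpose_mul_add_of_transpose_eq_neg (R s - R' s) (hskew s)]
    exact hD.trace_transpose_mul_self
  exact is_const_of_deriv_eq_zero (fun s => (hderiv s).differentiableAt)
    (fun s => (hderiv s).deriv) t 0
end
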